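/- Let r ≥ 1 and 1 ≤ k ≤ r. Suppose γ : ℂ × ℂ^r → ℂ is C^∞-smooth (infinitely differentiable as a function of the underlying real variables), and suppose there exists a function h, defined and C^∞-smooth on the open set U = {(s,τ) ∈ ℂ × ℂ^r : τ₁⋯τ_k ≠ 0}, such that γ(s,τ) = conj(s)·h(s,τ) for all (s,τ) ∈ U. Then there exists a C^∞-smooth function g : ℂ × ℂ^r → ℂ such that γ(s,τ) = conj(s)·g(s,τ) for all (s,τ) ∈ ℂ × ℂ^r; that is, γ(s,τ)/conj(s) is smooth everywhere. -/

import Mathlib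

open scoped ContDiff Topology

/-- Smoothness of integrals of smooth functions depending on a parameter. -/
lemma contDiff_param_integral {H : Type} [NormedAddCommGroup H] [NormedSpace ℝ H] [ProperSpace H]
    (n : ℕ) : ∀ {E : Type} [NormedAddCommGroup E] [NormedSpace ℝ E]
    (F : H × ℝ → E), ContDiff ℝ ∞ F → ContDiff ℝ n (fun x => ∫ t in (0:ℝ)..1, F (x, t)) := by
  induction n with
  | zero =>
    intro E _ _ F hF
    simp only [Nat.cast_zero, contDiff_zero]
    exact intervalIntegral.continuous_parametric_intervalIntegral_of_continuous'
      (f := fun x t => F (x, t)) hF.continuous 0 1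
  | succ n ih =>
    intro E _ _ F hF
    have hF' : ContDiff ℝ ∞
        (fun p : H × ℝ => (fderiv ℝ F p).comp (ContinuousLinearMap.inl ℝ H ℝ)) :=
      (hF.fderiv_right (m := ∞) (by simp)).clm_comp contDiff_const
    rw [Nat.cast_add, Nat.cast_one, contDiff_succ_iff_hasFDerivAt]
    refine ⟨_, ih _ hF', fun x₀ => ?_⟩
    obtain ⟨C, hC⟩ := ((isCompact_closedBall x₀ 1).prod (isCompact_Icc (a := (0:ℝ)) (b := 1))
      ).exists_bound_of_continuousOn hF'.continuous.continuousOn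
    refine intervalIntegral.hasFDerivAt_integral_of_dominated_of_fderiv_le
      (F := fun x t => F (x, t))
      (F' := fun x t => (fderiv ℝ F (x, t)).comp (ContinuousLinearMap.inl ℝ H ℝ))
      (bound := fun _ => C) (Metric.closedBall_mem_nhds x₀ one_pos) ?_ ?_ ?_ ?_ ?_ ?_
    · refine Filter.Eventually.of_forall fun x => Continuous.aestronglyMeasurable ?_
      exact hF.continuous.comp (by fun_prop)
    · exact (hF.continuous.comp (by fun_prop : Continuous fun t : ℝ => (x₀, t))
        ).intervalIntegrable _ _
    · exact (hF'.continuous.comp (by fun_prop : Continuous fun t : ℝ => (x₀, t))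
        ).aestronglyMeasurable
    · refine Filter.Eventually.of_forall fun t ht x hx => hC (x, t) ⟨hx, ?_⟩
      rw [Set.uIoc_of_le zero_le_one] at ht
      exact ⟨ht.1.le, ht.2⟩
    · exact intervalIntegrable_const
    · refine Filter.Eventually.of_forall fun t ht x hx => ?_
      have h1 : HasFDerivAt F (fderiv ℝ F (x, t)) (x, t) :=
        (hF.differentiable (by simp) _).hasFDerivAt
      exact h1.comp x (hasFDerivAt_prodMk_left x t)

lemma contDiff_param_integral_top {H E : Type} [NormedAddCommGroup H] [NormedSpace ℝ H]
    [ProperSpace H] [NormedAddCommGroup E] [NormedSpace ℝ E]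
    (F : H × ℝ → E) (hF : ContDiff ℝ ∞ F) : ContDiff ℝ ∞ (fun x => ∫ t in (0:ℝ)..1, F (x, t)) :=
  contDiff_infty.2 fun n => contDiff_param_integral n F hF

lemma phi_norm (a b : ℕ) (hab : b + 1 ≤ a) (s : ℂ) :
    ‖s ^ a * ((starRingEnd ℂ) s)⁻¹ ^ b‖ = ‖s‖ ^ (a - b) := by
  by_cases hs : s = 0
  · subst hs
    rw [zero_pow (by omega), norm_zero, zero_pow (by omega)]; simp
  · have : ‖s‖ ≠ 0 := norm_ne_zero_iff.2 hs
    obtain ⟨c, rfl⟩ : ∃ c, a = b + c := ⟨a - b, by omega⟩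
    simp only [norm_mul, norm_pow, norm_inv, RCLike.norm_conj, Nat.add_sub_cancel_left]
    rw [pow_add, mul_right_comm, ← mul_pow, mul_inv_cancel₀ this, one_pow, one_mul]

lemma phi_contDiff (m : ℕ) : ∀ a b : ℕ, b + m + 1 ≤ a →
    ContDiff ℝ m (fun s : ℂ => s ^ a * ((starRingEnd ℂ) s)⁻¹ ^ b) := by
  induction m with
  | zero =>
    intro a b hab
    simp only [Nat.cast_zero, contDiff_zero]
    rw [continuous_iff_continuousAt]
    intro s
    by_cases hs : s = 0
    · subst hs
      have h0 : (0:ℂ) ^ a * ((starRingEnd ℂ) 0)⁻¹ ^ b = 0 := by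
        rw [zero_pow (by omega), zero_mul]
      rw [ContinuousAt, h0, tendsto_zero_iff_norm_tendsto_zero]
      simp_rw [phi_norm a b (by omega)]
      have : Continuous fun s : ℂ => ‖s‖ ^ (a - b) := by fun_prop
      have h2 := this.tendsto 0
      rwa [norm_zero, zero_pow (by omega)] at h2
    · have h1 : (starRingEnd ℂ) s ≠ 0 := by simpa using hs
      have h2 : ContinuousAt (fun s : ℂ => (starRingEnd ℂ) s) s :=
        Complex.continuous_conj.continuousAt
      exact (continuousAt_id.pow a).mul ((h2.inv₀ h1).pow b)
  | succ m ih =>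
    intro a b hab
    rw [Nat.cast_add, Nat.cast_one, contDiff_succ_iff_hasFDerivAt]
    refine ⟨fun s => ((a : ℂ) * (s ^ (a - 1) * ((starRingEnd ℂ) s)⁻¹ ^ b)) •
        ContinuousLinearMap.id ℝ ℂ
      - ((b : ℂ) * (s ^ a * ((starRingEnd ℂ) s)⁻¹ ^ (b + 1))) •
        (Complex.conjCLE : ℂ →L[ℝ] ℂ), ?_, ?_⟩
    · exact ((contDiff_const.mul (ih (a - 1) b (by omega))).smul contDiff_const).sub
        ((contDiff_const.mul (ih a (b + 1) (by omega))).smul contDiff_const)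
    · intro s
      by_cases hs : s = 0
      · subst hs
        have h0 : (0:ℂ) ^ a * ((starRingEnd ℂ) 0)⁻¹ ^ b = 0 := by
          rw [zero_pow (by omega), zero_mul]
        beta_reduce
        rw [zero_pow (by omega : a - 1 ≠ 0), zero_pow (by omega : a ≠ 0)]
        simp only [zero_mul, mul_zero]
        rw [hasFDerivAt_iff_isLittleO_nhds_zero]
        simp only [zero_add, h0, sub_zero]
        have hL : ∀ v : ℂ, ((0 : ℂ) • ContinuousLinearMap.id ℝ ℂ
            - (0 : ℂ) • (Complex.conjCLE : ℂ →L[ℝ] ℂ)) v = 0 := fun v => by simp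
        simp only [hL, sub_zero]
        have h1 : (fun s : ℂ => ‖s‖ ^ (a - b)) =o[𝓝 0] fun s : ℂ => s := by
          have := Asymptotics.isLittleO_norm_pow_id (E' := ℂ) (n := a - b) (by omega)
          simpa using this
        exact (Asymptotics.IsBigO.of_bound 1 (Filter.Eventually.of_forall fun s => by
          rw [phi_norm a b (by omega)]; simp)).trans_isLittleO h1
      · have h1 : (starRingEnd ℂ) s ≠ 0 := by simpa using hs
        have hc : HasFDerivAt (fun s : ℂ => (starRingEnd ℂ) s) (Complex.conjCLE : ℂ →L[ℝ] ℂ) s :=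
          Complex.conjCLE.hasFDerivAt
        have hi := ((hasDerivAt_inv h1).pow b).complexToReal_fderiv.comp s hc
        have ha := (hasDerivAt_pow a s).complexToReal_fderiv
        have := ha.mul hi
        refine this.congr_fderiv ?_
        refine ContinuousLinearMap.ext fun v => ?_
        rcases b with _ | b
        · simp
        · simp
          ring

/-- The complex derivative `∂/∂s`. -/
noncomputable def dS (f : ℂ → ℂ) (s : ℂ) : ℂ :=
  (fderiv ℝ f s 1 - Complex.I * fderiv ℝ f s Complex.I) / 2

lemma dS_contDiff {f : ℂ → ℂ} (hf : ContDiff ℝ ∞ f) : ContDiff ℝ ∞ (dS f) := by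
  have h := hf.fderiv_right (m := ∞) (by simp)
  unfold dS
  exact ((h.clm_apply contDiff_const).sub
    (contDiff_const.mul (h.clm_apply contDiff_const))).div_const 2

lemma dS_mul {f g : ℂ → ℂ} (hf : ContDiff ℝ ∞ f) (hg : ContDiff ℝ ∞ g) (s : ℂ) :
    dS (fun z => f z * g z) s = dS f s * g s + f s * dS g s := by
  unfold dS
  rw [fderiv_fun_mul (hf.differentiable (by simp) _) (hg.differentiable (by simp) _)]
  simp
  ring

lemma dS_conj (s : ℂ) : dS (fun z => (starRingEnd ℂ) z) s = 0 := by
  have hc : HasFDerivAt (fun s : ℂ => (starRingEnd ℂ) s) (Complex.conjCLE : ℂ →L[ℝ] ℂ) s :=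
    Complex.conjCLE.hasFDerivAt
  unfold dS
  rw [hc.fderiv]
  simp

lemma dS_pow (n : ℕ) (s : ℂ) : dS (fun z => z ^ (n + 1)) s = (n + 1) * s ^ n := by
  unfold dS
  rw [((hasDerivAt_pow (n + 1) s).complexToReal_fderiv).fderiv]
  simp
  linear_combination (-(1/2:ℂ)*(n+1)*s^n) * Complex.I_mul_I

lemma conj_contDiff : ContDiff ℝ ∞ (fun z : ℂ => (starRingEnd ℂ) z) :=
  Complex.conjCLE.contDiff

lemma one_var (N : ℕ) : ∀ a f : ℂ → ℂ, ContDiff ℝ ∞ a → ContDiff ℝ ∞ f →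
    (∀ s, s ^ N * a s = (starRingEnd ℂ) s * f s) → a 0 = 0 := by
  induction N with
  | zero => intro a f _ _ h; simpa using h 0
  | succ N ih =>
    intro a f ha hf h
    have := ih (fun s => (N + 1) * a s + s * dS a s) (dS f)
      ((contDiff_const.mul ha).add (contDiff_id.mul (dS_contDiff ha))) (dS_contDiff hf) (by
        intro s
        have h1 : (fun z => z ^ (N + 1) * a z) = fun z => (starRingEnd ℂ) z * f z := funext h
        have h2 := congrFun (congrArg dS h1) s
        rw [dS_mul (f := fun z => z ^ (N + 1)) (contDiff_id.pow _) ha, dS_mul conj_contDiff hf, dS_conj, dS_pow] at h2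
        linear_combination h2)
    simp only [zero_mul, add_zero] at this
    exact (mul_eq_zero.1 this).resolve_left (by exact_mod_cast Nat.succ_ne_zero N)

/-- Hadamard's lemma. -/
lemma hadamard_split {r : ℕ} (F : ℂ × (Fin r → ℂ) → ℂ) (hF : ContDiff ℝ ∞ F)
    (h0 : ∀ τ, F (0, τ) = 0) : ∃ A B : ℂ × (Fin r → ℂ) → ℂ, ContDiff ℝ ∞ A ∧ ContDiff ℝ ∞ B ∧
      ∀ p, F p = p.1 * A p + (starRingEnd ℂ) p.1 * B p := by
  have hd : ContDiff ℝ ∞ (fderiv ℝ F) := hF.fderiv_right (m := ∞) (by simp)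
  have hl : ContDiff ℝ ∞ (fun q : (ℂ × (Fin r → ℂ)) × ℝ => ((q.2 : ℂ) * q.1.1, q.1.2)) :=
    ((Complex.ofRealCLM.contDiff.comp contDiff_snd).mul
      (contDiff_fst.comp contDiff_fst)).prodMk (contDiff_snd.comp contDiff_fst)
  have hv : ∀ v : ℂ × (Fin r → ℂ), ContDiff ℝ ∞ (fun q : (ℂ × (Fin r → ℂ)) × ℝ =>
      fderiv ℝ F ((q.2 : ℂ) * q.1.1, q.1.2) v) := fun v =>
    (hd.comp hl).clm_apply contDiff_const
  set Ga : (ℂ × (Fin r → ℂ)) × ℝ → ℂ := fun q =>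
    (fderiv ℝ F ((q.2 : ℂ) * q.1.1, q.1.2) (1, 0)
      - Complex.I * fderiv ℝ F ((q.2 : ℂ) * q.1.1, q.1.2) (Complex.I, 0)) / 2 with hGa
  set Gb : (ℂ × (Fin r → ℂ)) × ℝ → ℂ := fun q =>
    (fderiv ℝ F ((q.2 : ℂ) * q.1.1, q.1.2) (1, 0)
      + Complex.I * fderiv ℝ F ((q.2 : ℂ) * q.1.1, q.1.2) (Complex.I, 0)) / 2 with hGb
  have ca : ContDiff ℝ ∞ Ga := ((hv _).sub (contDiff_const.mul (hv _))).div_const 2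
  have cb : ContDiff ℝ ∞ Gb := ((hv _).add (contDiff_const.mul (hv _))).div_const 2
  refine ⟨_, _, contDiff_param_integral_top Ga ca, contDiff_param_integral_top Gb cb, ?_⟩
  rintro ⟨s, τ⟩
  have ia : IntervalIntegrable (fun t => Ga ((s, τ), t)) MeasureTheory.volume 0 1 :=
    (ca.continuous.comp (by fun_prop : Continuous fun t : ℝ => ((s, τ), t))).intervalIntegrable _ _
  have ib : IntervalIntegrable (fun t => Gb ((s, τ), t)) MeasureTheory.volume 0 1 :=
    (cb.continuous.comp (by fun_prop : Continuous fun t : ℝ => ((s, τ), t))).intervalIntegrable _ _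
  simp only
  rw [← intervalIntegral.integral_const_mul, ← intervalIntegral.integral_const_mul,
    ← intervalIntegral.integral_add (ia.const_mul _) (ib.const_mul _)]
  rw [intervalIntegral.integral_eq_sub_of_hasDerivAt (f := fun t : ℝ => F ((t : ℂ) * s, τ))]
  · simp [h0]
  · intro t _
    have h1 : HasFDerivAt F (fderiv ℝ F ((t : ℂ) * s, τ)) ((t : ℂ) * s, τ) :=
      (hF.differentiable (by simp) _).hasFDerivAt
    have h2 : HasDerivAt (fun t : ℝ => ((t : ℂ) * s, τ)) (s, 0) t := by
      have h3 : HasDerivAt (fun t : ℝ => (t : ℂ) * s) (1 * s) t :=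
        (Complex.ofRealCLM.hasDerivAt (x := t)).mul_const s
      rw [one_mul] at h3
      exact h3.prodMk (hasDerivAt_const t τ)
    refine (h1.comp_hasDerivAt t h2).congr_deriv ?_
    have hs : ((s, 0) : ℂ × (Fin r → ℂ)) = s.re • (1, 0) + s.im • (Complex.I, 0) := by
      ext <;> simp
    rw [hs, map_add, map_smul, map_smul]
    simp only [hGa, hGb, Complex.real_smul]
    generalize fderiv ℝ F ((t : ℂ) * s, τ) (1, 0) = X
    generalize fderiv ℝ F ((t : ℂ) * s, τ) (Complex.I, 0) = Y
    have e1 : s = s.re + s.im * Complex.I := (Complex.re_add_im s).symm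
    have e2 : (starRingEnd ℂ) s = s.re - s.im * Complex.I := by
      apply Complex.ext <;> simp
    rw [e2]
    nth_rewrite 3 [e1]
    linear_combination (s.im * Y) * Complex.I_mul_I
  · exact ((ia.const_mul _).add (ib.const_mul _))

lemma dense_tau (r k : ℕ) : Dense {τ : Fin r → ℂ | ∀ i : Fin r, (i : ℕ) < k → τ i ≠ 0} := by
  have : Dense (Set.pi Set.univ fun _ : Fin r => ({0}ᶜ : Set ℂ)) :=
    dense_pi _ fun i _ => dense_compl_singleton 0
  refine this.mono ?_
  intro τ hτ i _
  exact hτ i trivial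


/-- If `γ : ℂ × ℂʳ → ℂ` is smooth and `γ(s,τ)/s̄` is smooth on the open set where
`τ₁⋯τ_k ≠ 0` (i.e. `γ = s̄·h` there for some smooth `h`), then `γ(s,τ)/s̄` is smooth
everywhere: there is a smooth `g : ℂ × ℂʳ → ℂ` with `γ(s,τ) = s̄·g(s,τ)` everywhere. -/
theorem smooth_division_by_conj (r k : ℕ) (hk1 : 1 ≤ k) (hkr : k ≤ r)
    (γ : ℂ × (Fin r → ℂ) → ℂ) (hγ : ContDiff ℝ (⊤ : ℕ∞) γ)
    (h : ℂ × (Fin r → ℂ) → ℂ)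
    (hsmooth : ContDiffOn ℝ (⊤ : ℕ∞) h {p : ℂ × (Fin r → ℂ) | ∀ i : Fin r, (i : ℕ) < k → p.2 i ≠ 0})
    (heq : ∀ p : ℂ × (Fin r → ℂ), (∀ i : Fin r, (i : ℕ) < k → p.2 i ≠ 0) →
      γ p = (starRingEnd ℂ) p.1 * h p) :
    ∃ g : ℂ × (Fin r → ℂ) → ℂ, ContDiff ℝ (⊤ : ℕ∞) g ∧
      ∀ p : ℂ × (Fin r → ℂ), γ p = (starRingEnd ℂ) p.1 * g p := by

  have hslice : ∀ τ : Fin r → ℂ, ContDiff ℝ ∞ (fun s : ℂ => (s, τ)) := fun τ =>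
    contDiff_id.prodMk contDiff_const
  have key : ∀ N : ℕ, ∃ A B : ℂ × (Fin r → ℂ) → ℂ, ContDiff ℝ ∞ A ∧ ContDiff ℝ ∞ B ∧
      ∀ p, γ p = p.1 ^ N * A p + (starRingEnd ℂ) p.1 * B p := by
    intro N
    induction N with
    | zero => exact ⟨γ, 0, hγ, contDiff_const, by simp⟩
    | succ N ih =>
      obtain ⟨A, B, hA, hB, hAB⟩ := ih
      have hz : ∀ τ, A (0, τ) = 0 := by
        have hcl : Continuous fun τ : Fin r → ℂ => A (0, τ) :=
          hA.continuous.comp (by fun_prop)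
        have := hcl.ext_on (dense_tau r k) (continuous_const (y := (0:ℂ))) (by
          intro τ hτ
          refine one_var N (fun s => A (s, τ)) (fun s => h (s, τ) - B (s, τ))
            (hA.comp (hslice τ)) ?_ ?_
          · refine ContDiff.sub ?_ (hB.comp (hslice τ))
            have := hsmooth.comp (s := Set.univ) (hslice τ).contDiffOn (fun s _ => hτ)
            exact contDiffOn_univ.1 this
          · intro s
            have e1 := hAB (s, τ)
            have e2 := heq (s, τ) hτ
            simp only at e1 e2
            linear_combination e2 - e1)
        exact fun τ => congrFun this τ
      obtain ⟨A', B', hA', hB', hAB'⟩ := hadamard_split A hA hz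
      refine ⟨A', fun p => B p + p.1 ^ N * B' p, hA',
        hB.add ((contDiff_fst.pow N).mul hB'), fun p => ?_⟩
      rw [hAB p, hAB' p]
      ring
  have key2 : ∀ m : ℕ, ∃ g : ℂ × (Fin r → ℂ) → ℂ, ContDiff ℝ m g ∧
      ∀ p, γ p = (starRingEnd ℂ) p.1 * g p := by
    intro m
    obtain ⟨A, B, hA, hB, hAB⟩ := key (m + 2)
    refine ⟨fun p => (p.1 ^ (m + 2) * ((starRingEnd ℂ) p.1)⁻¹ ^ 1) * A p + B p, ?_, fun p => ?_⟩
    · exact (((phi_contDiff m (m + 2) 1 (by omega)).comp contDiff_fst).mul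
        (hA.of_le (by exact_mod_cast le_top))).add (hB.of_le (by exact_mod_cast le_top))
    · rw [hAB p]
      by_cases hs : p.1 = 0
      · simp [hs]
      · have h1 : (starRingEnd ℂ) p.1 ≠ 0 := by simpa using hs
        field_simp
  have hdense : Dense {p : ℂ × (Fin r → ℂ) | p.1 ≠ 0} := by
    have := (dense_compl_singleton (0:ℂ)).prod (dense_univ (X := Fin r → ℂ))
    exact this.mono fun p hp => hp.1
  obtain ⟨g, hg, hgeq⟩ := key2 0
  refine ⟨g, contDiff_infty.2 fun m => ?_, hgeq⟩
  obtain ⟨g', hg', hgeq'⟩ := key2 m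
  have : g = g' := hg.continuous.ext_on hdense hg'.continuous fun p hp => by
    have h1 : (starRingEnd ℂ) p.1 ≠ 0 := by simpa using hp
    exact mul_left_cancel₀ h1 ((hgeq p).symm.trans (hgeq' p))
  rw [this]
  exact hg'
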